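/- (Buckley's inequality, generalized) Let Ψ: (0,1] → ℝ₊ be decreasing with sΨ(s) increasing and ∫_0^1 ds/(sΨ(s)) < ∞. For a weight w on ℝ with dyadic grid 𝒟, let n_I := ∫_0^∞ N_I(t)Ψ(N_I(t)) dt where N_I is the normalized distribution function of w on I, and Δ_I w := ⟨w⟩_{I₊} − ⟨w⟩_{I₋}. Then for every dyadic interval J: Σ_{I ∈ 𝒟, I ⊂ J} n_I^{-1} (Δ_I w)² |I| ≤ C·∫_J w dx, with C an absolute constant (sum taken over I where w ≢ 0). -/

import Mathlib

open Set MeasureTheory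

/-- A dyadic interval is encoded as a pair `(k, n) : ℤ × ℤ`, standing for
`[k·2⁻ⁿ, (k+1)·2⁻ⁿ)`. -/
noncomputable def dyadicSet (I : ℤ × ℤ) : Set ℝ :=
  Ico ((I.1 : ℝ) * 2 ^ (-I.2)) (((I.1 : ℝ) + 1) * 2 ^ (-I.2))

/-- Length of a dyadic interval. -/
noncomputable def dlen (I : ℤ × ℤ) : ℝ := (2 : ℝ) ^ (-I.2)

/-- Left half `I₋` of a dyadic interval. -/
def dleft (I : ℤ × ℤ) : ℤ × ℤ := (2 * I.1, I.2 + 1)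

/-- Right half `I₊` of a dyadic interval. -/
def dright (I : ℤ × ℤ) : ℤ × ℤ := (2 * I.1 + 1, I.2 + 1)

/-- Average `⟨w⟩_I` of `w` over a dyadic interval. -/
noncomputable def davg (w : ℝ → ℝ) (I : ℤ × ℤ) : ℝ :=
  (∫ x in dyadicSet I, w x) / dlen I

/-- Martingale difference `Δ_I w = ⟨w⟩_{I₊} − ⟨w⟩_{I₋}`. -/
noncomputable def ddiff (w : ℝ → ℝ) (I : ℤ × ℤ) : ℝ :=
  davg w (dright I) - davg w (dleft I)

/-- Normalized distribution function `N_I^w(t) = |{x ∈ I : w(x) > t}| / |I|`. -/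
noncomputable def ndist (w : ℝ → ℝ) (I : ℤ × ℤ) (t : ℝ) : ℝ :=
  (volume {x ∈ dyadicSet I | t < w x}).toReal / dlen I

/-- The functional `𝐧_Ψ(N_I^w) = ∫_0^∞ N_I(t) Ψ(N_I(t)) dt`. -/
noncomputable def nPsi (Ψ : ℝ → ℝ) (w : ℝ → ℝ) (I : ℤ × ℤ) : ℝ :=
  ∫ t in Ioi (0:ℝ), ndist w I t * Ψ (ndist w I t)

lemma int_gap {f a b : ℝ → ℝ} {μ : Measure ℝ} (hf : Integrable f μ) (ha : Integrable a μ)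
    (hb : Integrable b μ) :
    ∫ t, (f t - (a t + b t) / 2) ∂μ =
      ∫ t, f t ∂μ - (∫ t, a t ∂μ + ∫ t, b t ∂μ) / 2 := by
  have hab : Integrable (fun t => (a t + b t) / 2) μ := (ha.add hb).div_const 2
  rw [integral_sub hf hab, integral_div, integral_add ha hb]

/-- The concave Bellman profile. -/
noncomputable def bphi (h : ℝ → ℝ) (s : ℝ) : ℝ :=
  ∫ u in Ioo (0:ℝ) 1, min s u * h u

lemma bphi_integrable {h : ℝ → ℝ} (hint : IntegrableOn h (Ioo 0 1)) (s : ℝ) :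
    IntegrableOn (fun u => min s u * h u) (Ioo 0 1) := by
  refine Integrable.bdd_mul (c := |s| + 1) hint ?_ ?_
  · exact (measurable_const.min measurable_id).aestronglyMeasurable
  · refine (ae_restrict_iff' measurableSet_Ioo).2 (Filter.Eventually.of_forall ?_)
    intro u hu
    rw [Real.norm_eq_abs, abs_le]
    have h1 := neg_abs_le s
    have h2 := le_abs_self s
    constructor
    · refine le_min ?_ ?_ <;> linarith [hu.1, hu.2, abs_nonneg s]
    · exact (min_le_right _ _).trans (by linarith [hu.2, abs_nonneg s])

lemma bphi_mono {h : ℝ → ℝ} (hint : IntegrableOn h (Ioo 0 1))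
    (h0 : ∀ u ∈ Ioo (0:ℝ) 1, 0 ≤ h u) : Monotone (bphi h) := by
  intro a b hab
  refine setIntegral_mono_on (bphi_integrable hint a) (bphi_integrable hint b)
    measurableSet_Ioo ?_
  intro u hu
  exact mul_le_mul_of_nonneg_right (min_le_min_right u hab) (h0 u hu)

lemma bphi_nonneg {h : ℝ → ℝ}
    (h0 : ∀ u ∈ Ioo (0:ℝ) 1, 0 ≤ h u) {s : ℝ} (hs : 0 ≤ s) : 0 ≤ bphi h s := by
  refine setIntegral_nonneg measurableSet_Ioo ?_
  intro u hu
  exact mul_nonneg (le_min hs hu.1.le) (h0 u hu)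

lemma bphi_le {h : ℝ → ℝ} (hint : IntegrableOn h (Ioo 0 1))
    (h0 : ∀ u ∈ Ioo (0:ℝ) 1, 0 ≤ h u) (s : ℝ) :
    bphi h s ≤ (∫ u in Ioo (0:ℝ) 1, h u) * s := by
  rw [mul_comm, ← integral_const_mul]
  refine setIntegral_mono_on (bphi_integrable hint s) (hint.const_mul s)
    measurableSet_Ioo ?_
  intro u hu
  exact mul_le_mul_of_nonneg_right (min_le_left _ _) (h0 u hu)

lemma min_gap (a b u : ℝ) : 0 ≤ min ((a + b) / 2) u - (min a u + min b u) / 2 := by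
  rcases le_total a u with h1 | h1 <;> rcases le_total b u with h2 | h2 <;>
    rcases le_total ((a + b) / 2) u with h3 | h3 <;> simp only [min_eq_left, min_eq_right, *] <;>
    linarith

lemma bphi_gap_aux {h : ℝ → ℝ} (hint : IntegrableOn h (Ioo 0 1))
    (h0 : ∀ u ∈ Ioo (0:ℝ) 1, 0 ≤ h u) {a b : ℝ} (ha : 0 ≤ a) (hab : a ≤ b) (hb : b ≤ 1)
    (hanti : ∀ u, 0 < u → u ≤ (a + b) / 2 → h ((a + b) / 2) ≤ h u) :
    h ((a + b) / 2) * (b - a) ^ 2 ≤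
      16 * (bphi h ((a + b) / 2) - (bphi h a + bphi h b) / 2) := by
  set m := (a + b) / 2 with hm
  have e1 : bphi h m - (bphi h a + bphi h b) / 2 =
      ∫ u in Ioo (0:ℝ) 1, (min m u - (min a u + min b u) / 2) * h u := by
    unfold bphi
    rw [← int_gap (bphi_integrable hint m) (bphi_integrable hint a) (bphi_integrable hint b)]
    congr 1
    ext u
    ring
  have hI : IntegrableOn (fun u => (min m u - (min a u + min b u) / 2) * h u) (Ioo 0 1) := by
    have := ((bphi_integrable hint m).sub
        (((bphi_integrable hint a).add (bphi_integrable hint b)).div_const 2))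
    refine this.congr (Filter.Eventually.of_forall fun u => ?_)
    simp only [Pi.sub_apply, Pi.add_apply]
    ring
  have hsub : Ioo a m ⊆ Ioo (0:ℝ) 1 := by
    intro u hu
    exact ⟨lt_of_le_of_lt ha hu.1, by linarith [hu.2]⟩
  have e2 : ∫ u in Ioo a m, (u - a) / 2 * h m ≤
      ∫ u in Ioo (0:ℝ) 1, (min m u - (min a u + min b u) / 2) * h u := by
    refine le_trans (setIntegral_mono_on ?_ (hI.mono_set hsub) measurableSet_Ioo ?_)
      (setIntegral_mono_set hI ?_ hsub.eventuallyLE)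
    · exact ((by fun_prop : Continuous fun u : ℝ => (u - a) / 2 * h m).integrableOn_Icc
        (a := a) (b := m)).mono_set Ioo_subset_Icc_self
    · intro u hu
      have hmb : m ≤ b := by linarith
      rw [min_eq_right hu.2.le, min_eq_left hu.1.le, min_eq_right (hu.2.le.trans hmb)]
      have h3 := hanti u (lt_of_le_of_lt ha hu.1) hu.2.le
      have h4 : 0 ≤ (u - a) / 2 := by linarith [hu.1]
      calc (u - a) / 2 * h m ≤ (u - a) / 2 * h u := mul_le_mul_of_nonneg_left h3 h4
        _ = _ := by ring
    · refine (ae_restrict_iff' measurableSet_Ioo).2 (Filter.Eventually.of_forall ?_)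
      intro u hu
      exact mul_nonneg (min_gap a b u) (h0 u hu)
  have e3 : ∫ u in Ioo a m, (u - a) / 2 * h m = (m - a) ^ 2 / 4 * h m := by
    rw [← integral_Ioc_eq_integral_Ioo, ← intervalIntegral.integral_of_le (by linarith),
      intervalIntegral.integral_mul_const, intervalIntegral.integral_div,
      intervalIntegral.integral_comp_sub_right (fun u => u) a, integral_id]
    ring
  rw [e1]
  have e4 : h m * (b - a) ^ 2 = 16 * ((m - a) ^ 2 / 4 * h m) := by
    rw [hm]; ring
  rw [e4, ← e3]
  linarith

lemma bphi_gap {h : ℝ → ℝ} (hint : IntegrableOn h (Ioo 0 1))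
    (h0 : ∀ u ∈ Ioo (0:ℝ) 1, 0 ≤ h u) {a b : ℝ} (ha : 0 ≤ a) (hb : 0 ≤ b) (ha1 : a ≤ 1)
    (hb1 : b ≤ 1)
    (hanti : ∀ u, 0 < u → u ≤ (a + b) / 2 → h ((a + b) / 2) ≤ h u) :
    h ((a + b) / 2) * (b - a) ^ 2 ≤
      16 * (bphi h ((a + b) / 2) - (bphi h a + bphi h b) / 2) := by
  rcases le_total a b with hab | hab
  · exact bphi_gap_aux hint h0 ha hab hb1 hanti
  · rw [add_comm a b] at hanti ⊢
    have := bphi_gap_aux hint h0 hb hab ha1 hanti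
    linarith [show (b - a) ^ 2 = (a - b) ^ 2 by ring]

lemma dlen_pos (I : ℤ × ℤ) : 0 < dlen I := by unfold dlen; positivity

lemma dlen_left (I : ℤ × ℤ) : dlen (dleft I) = dlen I / 2 := by
  simp only [dlen, dleft, neg_add]
  rw [zpow_add₀ (by norm_num)]; norm_num; ring

lemma dlen_right (I : ℤ × ℤ) : dlen (dright I) = dlen I / 2 := by
  simp only [dlen, dright, neg_add]
  rw [zpow_add₀ (by norm_num)]; norm_num; ring

lemma dyadicSet_eq (I : ℤ × ℤ) :
    dyadicSet I = Ico ((I.1 : ℝ) * dlen I) (((I.1 : ℝ) + 1) * dlen I) := rfl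

lemma dyadicSet_left (I : ℤ × ℤ) :
    dyadicSet (dleft I) = Ico ((I.1 : ℝ) * dlen I) (((I.1 : ℝ) + 1 / 2) * dlen I) := by
  rw [dyadicSet_eq, dlen_left]
  simp only [dleft]; push_cast
  congr 1 <;> ring

lemma dyadicSet_right (I : ℤ × ℤ) :
    dyadicSet (dright I) = Ico (((I.1 : ℝ) + 1 / 2) * dlen I) (((I.1 : ℝ) + 1) * dlen I) := by
  rw [dyadicSet_eq, dlen_right]
  simp only [dright]; push_cast
  congr 1 <;> ring

lemma dyadicSet_union (I : ℤ × ℤ) :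
    dyadicSet I = dyadicSet (dleft I) ∪ dyadicSet (dright I) := by
  have := dlen_pos I
  rw [dyadicSet_left, dyadicSet_right, dyadicSet_eq, Ico_union_Ico_eq_Ico] <;> nlinarith

lemma dyadicSet_disj (I : ℤ × ℤ) :
    Disjoint (dyadicSet (dleft I)) (dyadicSet (dright I)) := by
  rw [dyadicSet_left, dyadicSet_right, Set.disjoint_left]
  intro x hx hy
  exact absurd hx.2 (not_lt.2 hy.1)

lemma dyadicSet_meas (I : ℤ × ℤ) : MeasurableSet (dyadicSet I) := measurableSet_Ico

lemma dyadicSet_vol (I : ℤ × ℤ) : volume (dyadicSet I) = ENNReal.ofReal (dlen I) := by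
  rw [dyadicSet_eq, Real.volume_Ico]; congr 1; ring

lemma sub_ne_top (I : ℤ × ℤ) (w : ℝ → ℝ) (t : ℝ) :
    volume {x ∈ dyadicSet I | t < w x} ≠ ⊤ :=
  measure_ne_top_of_subset (sep_subset _ _) (by rw [dyadicSet_vol]; exact ENNReal.ofReal_ne_top)

lemma ndist_nonneg (w : ℝ → ℝ) (I : ℤ × ℤ) (t : ℝ) : 0 ≤ ndist w I t :=
  div_nonneg ENNReal.toReal_nonneg (dlen_pos I).le

lemma ndist_le_one (w : ℝ → ℝ) (I : ℤ × ℤ) (t : ℝ) : ndist w I t ≤ 1 := by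
  unfold ndist
  rw [div_le_one (dlen_pos I)]
  refine ENNReal.toReal_le_of_le_ofReal (dlen_pos I).le ?_
  rw [← dyadicSet_vol]
  exact measure_mono (sep_subset _ _)

lemma ndist_anti (w : ℝ → ℝ) (I : ℤ × ℤ) : Antitone (ndist w I) := by
  intro s t hst
  unfold ndist
  refine div_le_div_of_nonneg_right (ENNReal.toReal_mono (sub_ne_top I w s) (measure_mono ?_))
    (dlen_pos I).le
  intro x hx
  exact ⟨hx.1, hst.trans_lt hx.2⟩

lemma ndist_avg {w : ℝ → ℝ} (hw : Measurable w) (I : ℤ × ℤ) (t : ℝ) :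
    ndist w I t = (ndist w (dleft I) t + ndist w (dright I) t) / 2 := by
  unfold ndist
  have e : {x ∈ dyadicSet I | t < w x} =
      {x ∈ dyadicSet (dleft I) | t < w x} ∪ {x ∈ dyadicSet (dright I) | t < w x} := by
    rw [dyadicSet_union]; ext x; simp only [mem_union, mem_ofPred_eq]; tauto
  have hd : Disjoint {x ∈ dyadicSet (dleft I) | t < w x} {x ∈ dyadicSet (dright I) | t < w x} :=
    (dyadicSet_disj I).mono (sep_subset _ _) (sep_subset _ _)
  have hm : MeasurableSet {x ∈ dyadicSet (dright I) | t < w x} :=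
    (dyadicSet_meas _).inter (measurableSet_lt measurable_const hw)
  rw [e, measure_union hd hm, ENNReal.toReal_add (sub_ne_top _ w t) (sub_ne_top _ w t),
    dlen_left, dlen_right]
  have := dlen_pos I
  field_simp

lemma w_intOn {w : ℝ → ℝ} (hl : LocallyIntegrable w volume) (I : ℤ × ℤ) :
    IntegrableOn w (dyadicSet I) :=
  (hl.integrableOn_isCompact isCompact_Icc).mono_set
    (Ico_subset_Icc_self : dyadicSet I ⊆ Icc _ _)

lemma ndist_layer {w : ℝ → ℝ} (hw : Measurable w) (h0 : ∀ x, 0 ≤ w x)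
    (hl : LocallyIntegrable w volume) (I : ℤ × ℤ) :
    IntegrableOn (ndist w I) (Ioi 0) ∧ ∫ t in Ioi (0:ℝ), ndist w I t = davg w I := by
  have hi := w_intOn hl I
  have hset : ∀ t, (volume.restrict (dyadicSet I)) {x | t < w x} =
      volume {x ∈ dyadicSet I | t < w x} := by
    intro t
    rw [Measure.restrict_apply (measurableSet_lt measurable_const hw)]
    congr 1; ext x; simp [and_comm]
  have e1 : ∫⁻ x in dyadicSet I, ENNReal.ofReal (w x) =
      ∫⁻ t in Ioi (0:ℝ), volume {x ∈ dyadicSet I | t < w x} := by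
    rw [lintegral_eq_lintegral_meas_lt _ (Filter.Eventually.of_forall h0) hw.aemeasurable]
    simp only [hset]
  constructor
  · refine ⟨(ndist_anti w I).measurable.aestronglyMeasurable, ?_⟩
    rw [hasFiniteIntegral_iff_ofReal (Filter.Eventually.of_forall (ndist_nonneg w I))]
    have : ∀ t, ENNReal.ofReal (ndist w I t) =
        volume {x ∈ dyadicSet I | t < w x} * ENNReal.ofReal (dlen I)⁻¹ := by
      intro t
      rw [ndist, div_eq_mul_inv, ENNReal.ofReal_mul ENNReal.toReal_nonneg,
        ENNReal.ofReal_toReal (sub_ne_top I w t)]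
    simp only [this]
    rw [lintegral_mul_const' _ _ ENNReal.ofReal_ne_top, ← e1]
    refine ENNReal.mul_lt_top ?_ ENNReal.ofReal_lt_top
    have h2 := hi.2
    rwa [hasFiniteIntegral_iff_ofReal (Filter.Eventually.of_forall h0)] at h2
  · have := hi.integral_eq_integral_meas_lt (Filter.Eventually.of_forall h0)
    unfold ndist davg
    rw [integral_div, this]
    simp only [Measure.real, hset]

/-- The Bellman functional. -/
noncomputable def bB (h w : ℝ → ℝ) (I : ℤ × ℤ) : ℝ :=
  ∫ t in Ioi (0:ℝ), bphi h (ndist w I t)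

lemma bB_int {h : ℝ → ℝ} (hint : IntegrableOn h (Ioo 0 1))
    (hh0 : ∀ u ∈ Ioo (0:ℝ) 1, 0 ≤ h u) {w : ℝ → ℝ} (hw : Measurable w) (h0 : ∀ x, 0 ≤ w x)
    (hl : LocallyIntegrable w volume) (I : ℤ × ℤ) :
    IntegrableOn (fun t => bphi h (ndist w I t)) (Ioi 0) := by
  refine Integrable.mono' ((ndist_layer hw h0 hl I).1.const_mul (∫ u in Ioo (0:ℝ) 1, h u)) ?_ ?_
  · exact ((bphi_mono hint hh0).comp_antitone (ndist_anti w I)).measurable.aestronglyMeasurable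
  · refine Filter.Eventually.of_forall fun t => ?_
    rw [Real.norm_eq_abs, abs_of_nonneg (bphi_nonneg hh0 (ndist_nonneg w I t))]
    exact bphi_le hint hh0 _

lemma bB_nonneg {h : ℝ → ℝ} (hh0 : ∀ u ∈ Ioo (0:ℝ) 1, 0 ≤ h u) (w : ℝ → ℝ) (I : ℤ × ℤ) :
    0 ≤ bB h w I :=
  integral_nonneg fun t => bphi_nonneg hh0 (ndist_nonneg w I t)

lemma bB_le {h : ℝ → ℝ} (hint : IntegrableOn h (Ioo 0 1))
    (hh0 : ∀ u ∈ Ioo (0:ℝ) 1, 0 ≤ h u) {w : ℝ → ℝ} (hw : Measurable w) (h0 : ∀ x, 0 ≤ w x)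
    (hl : LocallyIntegrable w volume) (I : ℤ × ℤ) :
    dlen I * bB h w I ≤ (∫ u in Ioo (0:ℝ) 1, h u) * ∫ x in dyadicSet I, w x := by
  have h1 : bB h w I ≤ (∫ u in Ioo (0:ℝ) 1, h u) * davg w I := by
    rw [← (ndist_layer hw h0 hl I).2, ← integral_const_mul]
    exact integral_mono (bB_int hint hh0 hw h0 hl I) ((ndist_layer hw h0 hl I).1.const_mul _)
      fun t => bphi_le hint hh0 _
  have := dlen_pos I
  calc dlen I * bB h w I ≤ dlen I * ((∫ u in Ioo (0:ℝ) 1, h u) * davg w I) := by gcongr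
    _ = _ := by unfold davg; field_simp

/-- Elementary Cauchy–Schwarz. -/
lemma cs_aux {d F G : ℝ → ℝ} {μ : Measure ℝ} (hd : Integrable d μ) (hF : Integrable F μ)
    (hG : Integrable G μ) (hF0 : ∀ t, 0 ≤ F t) (hG0 : ∀ t, 0 ≤ G t)
    (h : ∀ t, d t ^ 2 ≤ 16 * (F t * G t)) :
    (∫ t, F t ∂μ)⁻¹ * (∫ t, d t ∂μ) ^ 2 ≤ 16 * ∫ t, G t ∂μ := by
  have hn : 0 ≤ ∫ t, F t ∂μ := integral_nonneg hF0
  have hg : 0 ≤ ∫ t, G t ∂μ := integral_nonneg hG0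
  rcases hn.eq_or_lt with hn | hn
  · rw [← hn]; simp; exact hg
  have key : ∀ l : ℝ, 0 < l → |∫ t, d t ∂μ| ≤ 2 * l * (∫ t, F t ∂μ) + 2 / l * ∫ t, G t ∂μ := by
    intro l hl
    refine (abs_integral_le_integral_abs).trans ?_
    rw [← integral_const_mul, ← integral_const_mul,
      ← integral_add (hF.const_mul _) (hG.const_mul _)]
    refine integral_mono hd.abs ((hF.const_mul _).add (hG.const_mul _)) fun t => ?_
    have hF1 := hF0 t
    have hG1 := hG0 t
    refine abs_le_of_sq_le_sq ((h t).trans ?_) (by positivity)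
    have : 4 * (2 * l * F t) * (2 / l * G t) = 16 * (F t * G t) := by field_simp; ring
    nlinarith [sq_nonneg (2 * l * F t - 2 / l * G t)]
  rw [inv_mul_le_iff₀ hn, ← sq_abs]
  set D := |∫ t, d t ∂μ| with hD
  have hD0 : 0 ≤ D := abs_nonneg _
  rcases hD0.eq_or_lt with h0 | h0
  · rw [← h0]
    have := mul_nonneg hn.le hg
    linarith
  have := key (D / (4 * ∫ t, F t ∂μ)) (by positivity)
  have h2 : 2 * (D / (4 * ∫ t, F t ∂μ)) * (∫ t, F t ∂μ) = D / 2 := by field_simp; ring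
  have h3 : 2 / (D / (4 * ∫ t, F t ∂μ)) * ∫ t, G t ∂μ =
    (8 * (∫ t, F t ∂μ) * ∫ t, G t ∂μ) / D := by field_simp; ring
  rw [h2, h3] at this
  have h4 : D / 2 ≤ (8 * (∫ t, F t ∂μ) * ∫ t, G t ∂μ) / D := by linarith
  rw [le_div_iff₀ h0] at h4
  nlinarith

lemma dyadic_split {I J : ℤ × ℤ} (h : dyadicSet I ⊆ dyadicSet J) :
    J.2 ≤ I.2 ∧ (I = J ∨ dyadicSet I ⊆ dyadicSet (dleft J) ∨
      dyadicSet I ⊆ dyadicSet (dright J)) := by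
  obtain ⟨k, n⟩ := I
  obtain ⟨j, m⟩ := J
  have hp := dlen_pos (k, n)
  have h' := h
  rw [dyadicSet_eq, dyadicSet_eq, Ico_subset_Ico_iff (by simp only; nlinarith)] at h'
  obtain ⟨h1, h2⟩ := h'
  simp only at h1 h2
  have h3 : dlen (k, n) ≤ dlen (j, m) := by nlinarith
  have hmn : m ≤ n := by
    unfold dlen at h3
    have := (zpow_le_zpow_iff_right₀ (by norm_num : (1:ℝ) < 2)).1 h3
    simp only at this
    omega
  refine ⟨hmn, ?_⟩
  rcases hmn.eq_or_lt with e | hlt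
  · left
    subst e
    have a1 : (j : ℝ) ≤ k := le_of_mul_le_mul_right h1 hp
    have a2 : (k : ℝ) + 1 ≤ j + 1 := le_of_mul_le_mul_right h2 hp
    have : k = j := by
      apply le_antisymm
      · exact_mod_cast (by linarith : (k:ℝ) ≤ j)
      · exact_mod_cast a1
    rw [this]
  · right
    obtain ⟨d, rfl⟩ : ∃ d : ℕ, n = m + 1 + d := ⟨(n - (m + 1)).toNat, by omega⟩
    have hl : dlen (j, m) = 2 * 2 ^ d * dlen (k, m + 1 + d) := by
      simp only [dlen]
      rw [← zpow_natCast, ← zpow_one_add₀ (by norm_num), ← zpow_add₀ (by norm_num)]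
      congr 1; ring
    rw [dyadicSet_left, dyadicSet_right, dyadicSet_eq]
    simp only
    rcases lt_or_ge k ((2 * j + 1) * 2 ^ d) with hk | hk
    · left
      refine Ico_subset_Ico h1 ?_
      have : (k : ℝ) + 1 ≤ (2 * j + 1) * 2 ^ d := by exact_mod_cast hk
      rw [hl]
      calc _ ≤ ((2 * j + 1) * 2 ^ d) * dlen (k, m + 1 + d) :=
            mul_le_mul_of_nonneg_right this hp.le
        _ = _ := by ring
    · right
      refine Ico_subset_Ico ?_ h2
      have : ((2 * j + 1) * 2 ^ d : ℝ) ≤ k := by exact_mod_cast hk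
      rw [hl]
      calc _ = ((2 * j + 1) * 2 ^ d) * dlen (k, m + 1 + d) := by ring
        _ ≤ _ := mul_le_mul_of_nonneg_right this hp.le

lemma tree_sum {f A : ℤ × ℤ → ℝ} (hf : ∀ I, 0 ≤ f I) (hA : ∀ I, 0 ≤ A I)
    (hstep : ∀ I, f I + A (dleft I) + A (dright I) ≤ A I) (m : ℕ) :
    ∀ (J : ℤ × ℤ) (s : Finset (ℤ × ℤ)),
      (∀ I ∈ s, dyadicSet I ⊆ dyadicSet J ∧ I.2 < J.2 + m) → ∑ I ∈ s, f I ≤ A J := by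
  classical
  induction m with
  | zero =>
    intro J s hs
    have : s = ∅ := by
      refine Finset.eq_empty_of_forall_notMem fun I hI => ?_
      have h1 := (hs I hI).2
      have h2 := (dyadic_split (hs I hI).1).1
      simp at h1
      omega
    rw [this]; simpa using hA J
  | succ m ih =>
    intro J s hs
    set s1 := s.filter fun I => dyadicSet I ⊆ dyadicSet (dleft J)
    set s2 := s.filter fun I => dyadicSet I ⊆ dyadicSet (dright J)
    have hsub : s ⊆ {J} ∪ (s1 ∪ s2) := by
      intro I hI
      have := (dyadic_split (hs I hI).1).2
      simp only [s1, s2, Finset.mem_union, Finset.mem_filter, Finset.mem_singleton]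
      tauto
    have b1 := ih (dleft J) s1 (by
      intro I hI
      have h1 := Finset.mem_filter.1 hI
      refine ⟨h1.2, ?_⟩
      have := (hs I h1.1).2
      simp only [dleft]; push_cast at this; omega)
    have b2 := ih (dright J) s2 (by
      intro I hI
      have h1 := Finset.mem_filter.1 hI
      refine ⟨h1.2, ?_⟩
      have := (hs I h1.1).2
      simp only [dright]; push_cast at this; omega)
    have u : ∀ a b : Finset (ℤ × ℤ), ∑ I ∈ a ∪ b, f I ≤ ∑ I ∈ a, f I + ∑ I ∈ b, f I := by
      intro a b
      rw [← Finset.sum_union_inter]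
      linarith [Finset.sum_nonneg (s := a ∩ b) (f := f) fun i _ => hf i]
    have c0 := Finset.sum_le_sum_of_subset_of_nonneg (f := f) hsub fun i _ _ => hf i
    have c1 := u {J} (s1 ∪ s2)
    have c2 := u s1 s2
    rw [Finset.sum_singleton] at c1
    linarith [hstep J]

/-- generalized Buckley inequality: for Ψ : (0,1] → ℝ₊
decreasing with sΨ(s) increasing and ∫_0 ds/(sΨ(s)) < ∞, there is a constant
C such that for every weight w (with 𝐧_Ψ(N_I^w) finite for all I) and every
dyadic interval J,
Σ_{I ⊂ J, w ≢ 0 on I} 𝐧_Ψ(N_I^w)⁻¹ (Δ_I w)² |I| ≤ C ∫_J w. -/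
theorem stmt10
    (Ψ : ℝ → ℝ)
    (hΨpos : ∀ s ∈ Ioc (0:ℝ) 1, 0 < Ψ s)
    (hΨanti : AntitoneOn Ψ (Ioc 0 1))
    (hmono : MonotoneOn (fun s => s * Ψ s) (Ioc 0 1))
    (hΨint : IntegrableOn (fun s => 1 / (s * Ψ s)) (Ioo 0 1)) :
    ∃ C > 0, ∀ w : ℝ → ℝ, Measurable w → (∀ x, 0 ≤ w x) →
      LocallyIntegrable w volume →
      (∀ I : ℤ × ℤ, IntegrableOn (fun t => ndist w I t * Ψ (ndist w I t)) (Ioi 0)) →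
      ∀ J : ℤ × ℤ,
        (∑' I : {I : ℤ × ℤ //
            dyadicSet I ⊆ dyadicSet J ∧ 0 < ∫ x in dyadicSet I, w x},
          (nPsi Ψ w I.1)⁻¹ * (ddiff w I.1) ^ 2 * dlen I.1)
        ≤ C * ∫ x in dyadicSet J, w x := by
  set h : ℝ → ℝ := fun s => 1 / (s * Ψ s) with hh
  have hpos : ∀ s ∈ Ioc (0:ℝ) 1, 0 < s * Ψ s := fun s hs => mul_pos hs.1 (hΨpos s hs)
  have hh0 : ∀ u ∈ Ioo (0:ℝ) 1, 0 ≤ h u := fun u hu =>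
    (one_div_pos.2 (hpos u ⟨hu.1, hu.2.le⟩)).le
  have hK : 0 ≤ ∫ u in Ioo (0:ℝ) 1, h u := setIntegral_nonneg measurableSet_Ioo hh0
  refine ⟨16 * (∫ u in Ioo (0:ℝ) 1, h u) + 1, by positivity, ?_⟩
  intro w hw h0 hl hn J
  -- the profile `s Ψ(s)` is nonnegative on `[0,1]`
  have hF0 : ∀ I t, 0 ≤ ndist w I t * Ψ (ndist w I t) := by
    intro I t
    rcases (ndist_nonneg w I t).eq_or_lt with e | e
    · rw [← e]; simp
    · exact (hpos _ ⟨e, ndist_le_one w I t⟩).le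
  have hn0 : ∀ I, 0 ≤ nPsi Ψ w I := fun I => integral_nonneg (hF0 I)
  have hf : ∀ I, 0 ≤ (nPsi Ψ w I)⁻¹ * (ddiff w I) ^ 2 * dlen I := fun I =>
    mul_nonneg (mul_nonneg (inv_nonneg.2 (hn0 I)) (sq_nonneg _)) (dlen_pos I).le
  have hgap : ∀ I t, 0 ≤ bphi h (ndist w I t) -
      (bphi h (ndist w (dleft I) t) + bphi h (ndist w (dright I) t)) / 2 ∧
      (ndist w (dright I) t - ndist w (dleft I) t) ^ 2 ≤
      16 * (ndist w I t * Ψ (ndist w I t) * (bphi h (ndist w I t) -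
      (bphi h (ndist w (dleft I) t) + bphi h (ndist w (dright I) t)) / 2)) := by
    intro I t
    have ha := ndist_nonneg w (dleft I) t
    have hb := ndist_nonneg w (dright I) t
    rcases (ndist_nonneg w I t).eq_or_lt with e | e
    · have e2 := ndist_avg hw I t
      rw [← e] at e2
      have ea : ndist w (dleft I) t = 0 := by linarith
      have eb : ndist w (dright I) t = 0 := by linarith
      rw [← e, ea, eb]
      simp
    · have h1 := ndist_le_one w I t
      have hp := hpos _ ⟨e, h1⟩
      have g := bphi_gap hΨint hh0 ha hb (ndist_le_one w (dleft I) t)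
        (ndist_le_one w (dright I) t) (by
          rw [← ndist_avg hw I t]
          intro u hu hum
          have hu1 : u ∈ Ioc (0:ℝ) 1 := ⟨hu, hum.trans h1⟩
          exact one_div_le_one_div_of_le (hpos u hu1) (hmono hu1 ⟨e, h1⟩ hum))
      rw [← ndist_avg hw I t] at g
      have hhp : 0 < 1 / (ndist w I t * Ψ (ndist w I t)) := one_div_pos.2 hp
      have g2 : 1 / (ndist w I t * Ψ (ndist w I t)) *
        (ndist w (dright I) t - ndist w (dleft I) t) ^ 2 ≤ 16 * (bphi h (ndist w I t) -
        (bphi h (ndist w (dleft I) t) + bphi h (ndist w (dright I) t)) / 2) := g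
      constructor
      · have := mul_nonneg hhp.le (sq_nonneg (ndist w (dright I) t - ndist w (dleft I) t))
        linarith
      · rw [one_div, inv_mul_le_iff₀ hp] at g2
        linarith
  have hbi := fun I => bB_int hΨint hh0 hw h0 hl I
  have hstep : ∀ I, (nPsi Ψ w I)⁻¹ * (ddiff w I) ^ 2 * dlen I +
      16 * (dlen (dleft I) * bB h w (dleft I)) + 16 * (dlen (dright I) * bB h w (dright I)) ≤
      16 * (dlen I * bB h w I) := by
    intro I
    have L1 := ndist_layer hw h0 hl (dleft I)
    have L2 := ndist_layer hw h0 hl (dright I)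
    have c := cs_aux (L2.1.sub L1.1) (hn I)
      ((hbi I).sub (((hbi (dleft I)).add (hbi (dright I))).div_const 2)) (hF0 I)
      (fun t => (hgap I t).1) (fun t => (hgap I t).2)
    have e1 : ∫ t in Ioi (0:ℝ), (ndist w (dright I) - ndist w (dleft I)) t = ddiff w I := by
      rw [ddiff, ← L1.2, ← L2.2, ← integral_sub L2.1 L1.1]
      rfl
    have e2 : ∫ t in Ioi (0:ℝ), ((fun t => bphi h (ndist w I t)) -
        fun t => ((fun t => bphi h (ndist w (dleft I) t)) +
          fun t => bphi h (ndist w (dright I) t)) t / 2) t =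
        bB h w I - (bB h w (dleft I) + bB h w (dright I)) / 2 := by
      exact int_gap (hbi I) (hbi (dleft I)) (hbi (dright I))
    rw [e1, e2] at c
    have c' := mul_le_mul_of_nonneg_right c (dlen_pos I).le
    rw [dlen_left, dlen_right]
    unfold nPsi
    linarith
  have hJ0 : 0 ≤ ∫ x in dyadicSet J, w x := integral_nonneg h0
  have hbound := bB_le hΨint hh0 hw h0 hl J
  refine Real.tsum_le_of_sum_le (fun I => hf I.1) ?_
  intro s
  classical
  have hs := tree_sum (f := fun I => (nPsi Ψ w I)⁻¹ * (ddiff w I) ^ 2 * dlen I)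
    (A := fun I => 16 * (dlen I * bB h w I)) hf
    (fun I => mul_nonneg (by norm_num) (mul_nonneg (dlen_pos I).le (bB_nonneg hh0 w I))) hstep
    (s.sup fun I => (I.1.2 - J.2).toNat + 1) J (s.map (Function.Embedding.subtype _)) (by
      intro I hI
      obtain ⟨K, hKs, rfl⟩ := Finset.mem_map.1 hI
      refine ⟨K.2.1, ?_⟩
      have := Finset.le_sup (f := fun I : {I : ℤ × ℤ //
            dyadicSet I ⊆ dyadicSet J ∧ 0 < ∫ x in dyadicSet I, w x} =>
              (I.1.2 - J.2).toNat + 1) hKs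
      simp only [Function.Embedding.subtype_apply]
      omega)
  rw [Finset.sum_map] at hs
  refine hs.trans ?_
  linarith
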